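/- Let n ∈ ℕ, a₀, b₀ > 0, T ∈ ℝ, and define L(a) = n·a·log(a) − n·log Γ(a) − (T+n)·a + (a₀−1)·log(a) − b₀·a for a > 0, with d₁(a) = L′(a) and d₂(a) = L″(a). If a > 0 satisfies d₁(a) + 1/a = 0, then a·d₂(a) + d₁(a) ≠ 0. -/

import Mathlib

open Filter Topology

theorem Real.contDiffAt_log_Gamma {x : ℝ} (hx : 0 < x) :
    ContDiffAt ℝ 2 (fun y => Real.log (Real.Gamma y)) x := by
  have h : ContDiff ℝ 2 (fun y : ℝ => ((Complex.Gamma y)⁻¹).re) :=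
    (Complex.differentiable_one_div_Gamma.contDiff (n := 2)).real_of_complex
  have h' : ContDiff ℝ 2 (fun y : ℝ => (Real.Gamma y)⁻¹) := by
    convert h using 2 with y
    rw [Complex.Gamma_ofReal, ← Complex.ofReal_inv, Complex.ofReal_re]
  have h0 : (Real.Gamma x)⁻¹ ≠ 0 := inv_ne_zero (Real.Gamma_pos_of_pos hx).ne'
  have h2 := (h'.contDiffAt.log h0).neg
  simpa only [Real.log_inv, neg_neg] using h2

theorem Real.differentiableAt_log_Gamma {x : ℝ} (hx : 0 < x) :
    DifferentiableAt ℝ (fun y => Real.log (Real.Gamma y)) x :=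
  (contDiffAt_log_Gamma hx).differentiableAt (by norm_num)

theorem Real.differentiableAt_deriv_log_Gamma {x : ℝ} (hx : 0 < x) :
    DifferentiableAt ℝ (deriv fun y => Real.log (Real.Gamma y)) x :=
  ((contDiffAt_log_Gamma hx).derivWithin (m := 1) (by norm_num)).differentiableAt (by norm_num)

theorem Real.deriv_log_Gamma_add_one {x : ℝ} (hx : 0 < x) :
    deriv (fun y => Real.log (Real.Gamma y)) (x + 1) =
      deriv (fun y => Real.log (Real.Gamma y)) x + x⁻¹ := by
  rw [← deriv_comp_add_const, ← Real.deriv_log,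
    ← deriv_add (differentiableAt_log_Gamma hx) (Real.differentiableAt_log hx.ne')]
  apply EventuallyEq.deriv_eq
  filter_upwards [eventually_gt_nhds hx] with y hy
  simp only [Pi.add_apply]
  rw [Real.Gamma_add_one hy.ne', Real.log_mul hy.ne' (Real.Gamma_pos_of_pos hy).ne', add_comm]

theorem Real.deriv_deriv_log_Gamma_add_one {x : ℝ} (hx : 0 < x) :
    deriv (deriv fun y => Real.log (Real.Gamma y)) (x + 1) =
      deriv (deriv fun y => Real.log (Real.Gamma y)) x - (x ^ 2)⁻¹ := by
  have h : HasDerivAt (fun y => deriv (fun z => Real.log (Real.Gamma z)) y + y⁻¹)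
      (deriv (deriv fun y => Real.log (Real.Gamma y)) x + -(x ^ 2)⁻¹) x :=
    (differentiableAt_deriv_log_Gamma hx).hasDerivAt.add (hasDerivAt_inv hx.ne')
  rw [← deriv_comp_add_const, sub_eq_add_neg, ← h.deriv]
  apply EventuallyEq.deriv_eq
  filter_upwards [eventually_gt_nhds hx] with y hy using deriv_log_Gamma_add_one hy

theorem Real.deriv_deriv_log_Gamma_nonneg {x : ℝ} (hx : 0 < x) :
    0 ≤ deriv (deriv fun y => Real.log (Real.Gamma y)) x := by
  have h : MonotoneOn (deriv fun y => Real.log (Real.Gamma y)) (Set.Ioi 0) :=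
    Real.convexOn_log_Gamma.monotoneOn_deriv fun y hy => differentiableAt_log_Gamma hy
  rw [← derivWithin_of_isOpen isOpen_Ioi (Set.mem_Ioi.2 hx)]
  exact h.derivWithin_nonneg

theorem Real.inv_sub_inv_add_natCast_le_deriv_deriv_log_Gamma (N : ℕ) {x : ℝ} (hx : 0 < x) :
    x⁻¹ - (x + N)⁻¹ ≤ deriv (deriv fun y => Real.log (Real.Gamma y)) x := by
  induction N generalizing x with
  | zero => simpa using deriv_deriv_log_Gamma_nonneg hx
  | succ N ih =>
    have h := ih (x := x + 1) (by positivity)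
    rw [deriv_deriv_log_Gamma_add_one hx] at h
    have h1 : x⁻¹ - (x + 1)⁻¹ ≤ (x ^ 2)⁻¹ := by
      rw [inv_sub_inv hx.ne' (by positivity), ← one_div (x ^ 2),
        div_le_div_iff₀ (by positivity) (by positivity)]
      nlinarith
    have h2 : x + 1 + (N : ℝ) = x + ((N + 1 : ℕ) : ℝ) := by push_cast; ring
    rw [h2] at h
    linarith

theorem Real.inv_le_deriv_deriv_log_Gamma {x : ℝ} (hx : 0 < x) :
    x⁻¹ ≤ deriv (deriv fun y => Real.log (Real.Gamma y)) x := by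
  have h : Tendsto (fun N : ℕ => x⁻¹ - (x + (N : ℝ))⁻¹) atTop (𝓝 (x⁻¹ - 0)) :=
    tendsto_const_nhds.sub
      (tendsto_atTop_add_const_left _ x tendsto_natCast_atTop_atTop).inv_tendsto_atTop
  rw [sub_zero] at h
  exact le_of_tendsto' h fun N => inv_sub_inv_add_natCast_le_deriv_deriv_log_Gamma N hx

/-- With L(a) = n·a·log a − n·log Γ(a) − (T+n)·a + (a₀−1)·log a − b₀·a,
    d₁ = L′, d₂ = L″: if a > 0 satisfies d₁(a) + 1/a = 0, then a·d₂(a) + d₁(a) ≠ 0. -/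
theorem gamma_shape_denominator_ne_zero (n : ℕ) (a0 b0 : ℝ)
    (ha0 : 0 < a0) (hb0 : 0 < b0) (T : ℝ)
    (L : ℝ → ℝ)
    (hL : L = fun a : ℝ => n * a * Real.log a - n * Real.log (Real.Gamma a)
      - (T + n) * a + (a0 - 1) * Real.log a - b0 * a)
    (d1 d2 : ℝ → ℝ) (hd1 : d1 = deriv L) (hd2 : d2 = deriv (deriv L))
    (a : ℝ) (ha : 0 < a) (hroot : d1 a + 1 / a = 0) :
    a * d2 a + d1 a ≠ 0 := by
  have hL1 : ∀ x : ℝ, 0 < x → HasDerivAt L (n * Real.log x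
      - n * deriv (fun y => Real.log (Real.Gamma y)) x - T + (a0 - 1) * x⁻¹ - b0) x := by
    intro x hx
    rw [hL]
    have hlog := Real.hasDerivAt_log hx.ne'
    have hG := (Real.differentiableAt_log_Gamma hx).hasDerivAt
    refine ((((((hasDerivAt_id x).const_mul (n : ℝ)).mul hlog).sub (hG.const_mul (n : ℝ))).sub
      ((hasDerivAt_id x).const_mul (T + n))).add (hlog.const_mul (a0 - 1))).sub
      ((hasDerivAt_id x).const_mul b0) |>.congr_deriv ?_
    simp only [id]
    field_simp
    ring
  have hL2 : HasDerivAt (deriv L) (n * a⁻¹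
      - n * deriv (deriv fun y => Real.log (Real.Gamma y)) a + (a0 - 1) * -(a ^ 2)⁻¹) a := by
    have hG := (Real.differentiableAt_deriv_log_Gamma ha).hasDerivAt
    have h := ((((((Real.hasDerivAt_log ha.ne').const_mul (n : ℝ)).sub
      (hG.const_mul (n : ℝ))).sub_const T).add
      ((hasDerivAt_inv ha.ne').const_mul (a0 - 1))).sub_const b0)
    refine h.congr_of_eventuallyEq ?_
    filter_upwards [eventually_gt_nhds ha] with y hy using (hL1 y hy).deriv
  have hψ := Real.inv_le_deriv_deriv_log_Gamma ha
  rw [hd2, hL2.deriv, eq_neg_of_add_eq_zero_left hroot]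
  set t := deriv (deriv fun y => Real.log (Real.Gamma y)) a
  have ht : 0 ≤ n * (a * (t - a⁻¹)) := by
    have := sub_nonneg.2 hψ
    positivity
  have hpos : 0 < a0 / a := div_pos ha0 ha
  have key : a * (n * a⁻¹ - n * t + (a0 - 1) * -(a ^ 2)⁻¹) + -(1 / a)
      = -(n * (a * (t - a⁻¹))) - a0 / a := by
    field_simp
    ring
  rw [key]
  exact (by linarith : -(n * (a * (t - a⁻¹))) - a0 / a < 0).ne
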